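/- arXiv:2002.06335 — 2 statements merged into one kernel-verified Lean document; each statement's English description precedes it below -/
import Mathlib

section
/- For all vectors ω, γ ∈ ℝ³ one has the algebraic identities (J·ω, γ) = (I·ω, γ) and −(J·ω, r) = R·(I·ω, γ) + a·i₃·ω₃; consequently the area integral C = (J·ω, γ), the Jellett integral G = −(J·ω, r) and the Lagrange integral F = i₃·ω₃ satisfy C = (G − a·F)/R. -/
open Matrix

noncomputable section

/-- Cross product on ℝ³. -/
def cross3 (u v : Fin 3 → ℝ) : Fin 3 → ℝ :=
  ![u 1 * v 2 - u 2 * v 1, u 2 * v 0 - u 0 * v 2, u 0 * v 1 - u 1 * v 0]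

/-- Action of the axisymmetric inertia tensor I = diag(i₁,i₁,i₃). -/
def inert (i₁ i₃ : ℝ) (w : Fin 3 → ℝ) : Fin 3 → ℝ := ![i₁ * w 0, i₁ * w 1, i₃ * w 2]

/-- Action of J = I + m·(r×γ)⊗(r×γ), where (u⊗u)·w = (u,w)·u. -/
def Japp (m i₁ i₃ : ℝ) (r γ w : Fin 3 → ℝ) : Fin 3 → ℝ :=
  inert i₁ i₃ w + (m * (cross3 r γ ⬝ᵥ w)) • cross3 r γ

theorem cross3_dotProduct_left (u v : Fin 3 → ℝ) : cross3 u v ⬝ᵥ u = 0 := by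
  simp only [cross3, dotProduct, Fin.sum_univ_three, cons_val]
  ring

theorem cross3_dotProduct_right (u v : Fin 3 → ℝ) : cross3 u v ⬝ᵥ v = 0 := by
  simp only [cross3, dotProduct, Fin.sum_univ_three, cons_val]
  ring

theorem Japp_dotProduct_left (m i₁ i₃ : ℝ) (r γ w : Fin 3 → ℝ) :
    Japp m i₁ i₃ r γ w ⬝ᵥ r = inert i₁ i₃ w ⬝ᵥ r := by
  simp [Japp, add_dotProduct, smul_dotProduct, cross3_dotProduct_left]

theorem Japp_dotProduct_right (m i₁ i₃ : ℝ) (r γ w : Fin 3 → ℝ) :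
    Japp m i₁ i₃ r γ w ⬝ᵥ γ = inert i₁ i₃ w ⬝ᵥ γ := by
  simp [Japp, add_dotProduct, smul_dotProduct, cross3_dotProduct_right]

theorem inert_dotProduct_axis (i₁ i₃ : ℝ) (w : Fin 3 → ℝ) :
    inert i₁ i₃ w ⬝ᵥ ![0, 0, 1] = i₃ * w 2 := by
  simp [inert, dotProduct, Fin.sum_univ_three]

/-- For all ω, γ ∈ ℝ³ one has (J·ω, γ) = (I·ω, γ) and −(J·ω, r) = R·(I·ω, γ) + a·i₃·ω₃;
consequently the area integral C = (J·ω, γ), the Jellett integral G = −(J·ω, r) and the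
Lagrange integral F = i₃·ω₃ satisfy C = (G − a·F)/R. -/
theorem area_jellett_lagrange_relation
    (R m a i₁ i₃ : ℝ) (hR : 0 < R) (hm : 0 < m) (hi₁ : 0 < i₁) (hi₃ : 0 < i₃)
    (ω γ : Fin 3 → ℝ) (r : Fin 3 → ℝ)
    (hr : r = (-R) • γ - a • (![0, 0, 1] : Fin 3 → ℝ))
    (C G F : ℝ)
    (hC : C = Japp m i₁ i₃ r γ ω ⬝ᵥ γ)
    (hG : G = -(Japp m i₁ i₃ r γ ω ⬝ᵥ r))
    (hF : F = i₃ * ω 2) :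
    C = inert i₁ i₃ ω ⬝ᵥ γ ∧
    G = R * (inert i₁ i₃ ω ⬝ᵥ γ) + a * (i₃ * ω 2) ∧
    C = (G - a * F) / R := by
  have hC' : C = inert i₁ i₃ ω ⬝ᵥ γ := by rw [hC, Japp_dotProduct_right]
  have hG' : G = R * (inert i₁ i₃ ω ⬝ᵥ γ) + a * (i₃ * ω 2) := by
    rw [hG, Japp_dotProduct_left, hr, dotProduct_sub, dotProduct_smul, dotProduct_smul,
      inert_dotProduct_axis, smul_eq_mul, smul_eq_mul]
    ring
  refine ⟨hC', hG', ?_⟩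
  rw [eq_div_iff hR.ne', hG', hF, hC']
  ring
end
end

section
/- (Jellett integral for the Chaplygin ball.) Let I be an arbitrary symmetric positive-definite 3×3 matrix (a balanced, dynamically asymmetric ball), a = 0, so that r = −R·γ. If (M_f(t), r(t)) = 0 for all t, then the Jellett integral G = −(J(γ)·ω, r) is constant along every solution of I·ω̇ + ω×(I·ω) = N·(r×γ) + M_f, γ̇ = γ×ω, for an arbitrary normal reaction N(t). -/
open Matrix

noncomputable section

theorem cross3_smul_self (c : ℝ) (v : Fin 3 → ℝ) : cross3 (c • v) v = 0 := by
  ext i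
  fin_cases i <;> simp [cross3] <;> ring

/-- Cyclic invariance of the scalar triple product. -/
theorem cross3_dotProduct_rotate (u v w : Fin 3 → ℝ) :
    cross3 u v ⬝ᵥ w = v ⬝ᵥ cross3 w u := by
  simp only [cross3, vec3_dotProduct, cons_val]
  ring

theorem hasDerivAt_dotProduct {ι : Type*} [Fintype ι] {u v : ℝ → ι → ℝ} {u' v' : ι → ℝ} {t : ℝ}
    (hu : HasDerivAt u u' t) (hv : HasDerivAt v v' t) :
    HasDerivAt (fun s => u s ⬝ᵥ v s) (u' ⬝ᵥ v t + u t ⬝ᵥ v') t := by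
  simp only [dotProduct, ← Finset.sum_add_distrib]
  exact HasDerivAt.fun_sum fun i _ => (hasDerivAt_pi.1 hu i).fun_mul (hasDerivAt_pi.1 hv i)

theorem hasDerivAt_mulVec {ι κ : Type*} [Fintype ι] [Fintype κ] (A : Matrix κ ι ℝ)
    {u : ℝ → ι → ℝ} {u' : ι → ℝ} {t : ℝ} (hu : HasDerivAt u u' t) :
    HasDerivAt (fun s => A.mulVec (u s)) (A.mulVec u') t :=
  (A.mulVecLin.toContinuousLinearMap.hasFDerivAt).comp_hasDerivAt t hu

/-- Jellett integral for the Chaplygin ball: I an arbitrary symmetric positive-definite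
matrix, a = 0 so that r = −R·γ, J(γ) = I + m·(r×γ)⊗(r×γ) with (u⊗u)·w = (u,w)·u.
If (M_f, r) = 0 for all t, then the Jellett integral G = −(J(γ)·ω, r) is constant along
every solution of I·ω̇ + ω×(I·ω) = N·(r×γ) + M_f, γ̇ = γ×ω, for an arbitrary normal
reaction N. -/
theorem jellett_integral_chaplygin_ball
    (R m : ℝ) (hR : 0 < R) (hm : 0 < m)
    (I : Matrix (Fin 3) (Fin 3) ℝ) (hIsymm : I.IsSymm) (hIpos : I.PosDef)
    (ω γ ω' γ' Mf : ℝ → Fin 3 → ℝ) (N : ℝ → ℝ) (r : ℝ → Fin 3 → ℝ)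
    (hω : ∀ t, HasDerivAt ω (ω' t) t)
    (hγ : ∀ t, HasDerivAt γ (γ' t) t)
    (hγunit : ∀ t, γ t ⬝ᵥ γ t = 1)
    (hr : ∀ t, r t = (-R) • γ t)
    -- angular equations of motion
    (heqω : ∀ t, I.mulVec (ω' t) + cross3 (ω t) (I.mulVec (ω t))
      = N t • cross3 (r t) (γ t) + Mf t)
    (heqγ : ∀ t, γ' t = cross3 (γ t) (ω t))
    -- the hypothesis (M_f, r) = 0
    (hMf : ∀ t, Mf t ⬝ᵥ r t = 0)
    -- the Jellett integral
    (G : ℝ → ℝ)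
    (hG : ∀ t, G t = -((I.mulVec (ω t)
        + (m * (cross3 (r t) (γ t) ⬝ᵥ ω t)) • cross3 (r t) (γ t)) ⬝ᵥ r t)) :
    ∀ t s : ℝ, G t = G s := by
  have hcross : ∀ t, cross3 (r t) (γ t) = 0 := fun t => by
    rw [hr, cross3_smul_self]
  have hGeq : G = fun t => R * (I.mulVec (ω t) ⬝ᵥ γ t) := by
    funext t
    rw [hG, hcross, hr]
    simp
  have hMfγ : ∀ t, Mf t ⬝ᵥ γ t = 0 := fun t => by
    have h := hMf t
    rw [hr, dotProduct_smul, smul_eq_mul] at h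
    exact (mul_eq_zero.1 h).resolve_left (neg_ne_zero.2 hR.ne')
  have hderiv : ∀ t, HasDerivAt G 0 t := fun t => by
    have hI : I.mulVec (ω' t) = Mf t - cross3 (ω t) (I.mulVec (ω t)) := by
      rw [eq_sub_iff_add_eq, heqω, hcross, smul_zero, zero_add]
    have h := (hasDerivAt_dotProduct (hasDerivAt_mulVec I (hω t)) (hγ t)).const_mul R
    rwa [← hGeq, hI, sub_dotProduct, hMfγ, cross3_dotProduct_rotate, heqγ, zero_sub,
      neg_add_cancel, mul_zero] at h
  exact is_const_of_deriv_eq_zero (fun t => (hderiv t).differentiableAt)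
    fun t => (hderiv t).deriv
end
end
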